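/- For every n, the number of λ-terms of natural size n equals the number of zigzag-free binary trees with exactly n nodes. Equivalently, there is a size-preserving bijection between λ-terms (with the natural size) and zigzag-free binary trees (with size = number of nodes). -/

import Mathlib

inductive Term : Type
  | idx : ℕ → Term
  | app : Term → Term → Term
  | abs : Term → Term

def Term.size : Term → ℕ
  | .idx n => n + 1
  | .app t u => t.size + u.size + 1
  | .abs t => t.size + 1

noncomputable def L (n : ℕ) : ℕ := Nat.card {t : Term // t.size = n}

-- Zigzag-free binary trees: `BZ1` is an arbitrary zigzag-free tree,
-- `BZ2` is a zigzag-free tree that, following left branches only, reaches a leaf.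
-- BZ1 ::= *(right : BZ1) | BZ2;  BZ2 ::= * | *(left : BZ2) | *(left : BZ2, right : BZ1).
mutual
  inductive BZ1 : Type
    | node : BZ1 → BZ1           -- a node with only a right child
    | of : BZ2 → BZ1             -- coercion from BZ2 (no new node)
  inductive BZ2 : Type
    | leaf : BZ2
    | left : BZ2 → BZ2
    | both : BZ2 → BZ1 → BZ2
end

mutual
  def BZ1.size : BZ1 → ℕ
    | .node t => t.size + 1
    | .of t => t.size
  def BZ2.size : BZ2 → ℕ
    | .leaf => 1
    | .left t => t.size + 1
    | .both t u => t.size + u.size + 1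
end

/-- Adds one successor to an index, or one abstraction in front of the function part of an
application. -/
def Term.bump : Term → Term
  | .idx n => .idx (n + 1)
  | .app t u => .app (.abs t) u
  | .abs t => .abs (.abs t)

theorem Term.size_bump (t : Term) : t.bump.size = t.size + 1 := by
  cases t <;> simp only [Term.bump, Term.size]
  omega

mutual
  /-- The term corresponding to a zigzag-free tree. -/
  def BZ1.toTerm : BZ1 → Term
    | .node t => .abs t.toTerm
    | .of t => t.toTerm
  /-- The term, not an abstraction, corresponding to a tree whose left branch ends in a leaf. -/
  def BZ2.toTerm : BZ2 → Term
    | .leaf => .idx 0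
    | .left t => t.toTerm.bump
    | .both t u => .app t.toTerm u.toTerm
end

mutual
  theorem BZ1.size_toTerm : ∀ t : BZ1, t.toTerm.size = t.size
    | .node t => by simp only [BZ1.toTerm, Term.size, BZ1.size, BZ1.size_toTerm t]
    | .of t => by simp only [BZ1.toTerm, BZ1.size, BZ2.size_toTerm t]
  theorem BZ2.size_toTerm : ∀ t : BZ2, t.toTerm.size = t.size
    | .leaf => by simp only [BZ2.toTerm, Term.size, BZ2.size]
    | .left t => by simp only [BZ2.toTerm, Term.size_bump, BZ2.size, BZ2.size_toTerm t]
    | .both t u => by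
      simp only [BZ2.toTerm, Term.size, BZ2.size, BZ2.size_toTerm t, BZ1.size_toTerm u]
end

/-- The left path with `n + 1` nodes. -/
def BZ2.leftPath : ℕ → BZ2
  | 0 => .leaf
  | n + 1 => .left (leftPath n)

/-- The tree of an application, given the trees of its two parts. -/
def BZ1.apply : BZ1 → BZ1 → BZ2
  | .node t, u => .left (t.apply u)
  | .of t, u => .both t u

/-- The zigzag-free tree corresponding to a term. -/
def Term.toTree : Term → BZ1
  | .idx n => .of (.leftPath n)
  | .app t u => .of (t.toTree.apply u.toTree)
  | .abs t => .node t.toTree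

theorem Term.toTree_bump {t : Term} {s : BZ2} (h : t.toTree = .of s) :
    t.bump.toTree = .of (.left s) := by
  cases t <;> simp_all [Term.bump, Term.toTree, BZ2.leftPath, BZ1.apply]

mutual
  theorem BZ1.toTree_toTerm : ∀ t : BZ1, t.toTerm.toTree = t
    | .node t => by simp only [BZ1.toTerm, Term.toTree, BZ1.toTree_toTerm t]
    | .of t => by simp only [BZ1.toTerm, BZ2.toTree_toTerm t]
  theorem BZ2.toTree_toTerm : ∀ t : BZ2, t.toTerm.toTree = .of t
    | .leaf => by simp only [BZ2.toTerm, Term.toTree, BZ2.leftPath]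
    | .left t => by simp only [BZ2.toTerm, Term.toTree_bump (BZ2.toTree_toTerm t)]
    | .both t u => by
      simp only [BZ2.toTerm, Term.toTree, BZ2.toTree_toTerm t, BZ1.toTree_toTerm u, BZ1.apply]
end

theorem BZ2.toTerm_leftPath (n : ℕ) : (leftPath n).toTerm = .idx n := by
  induction n with
  | zero => simp only [leftPath, BZ2.toTerm]
  | succ n ih => simp only [leftPath, BZ2.toTerm, ih, Term.bump]

theorem BZ1.toTerm_apply : ∀ t u : BZ1, (t.apply u).toTerm = .app t.toTerm u.toTerm
  | .node t, u => by
    simp only [BZ1.apply, BZ2.toTerm, BZ1.toTerm, BZ1.toTerm_apply t u, Term.bump]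
  | .of t, u => by simp only [BZ1.apply, BZ2.toTerm, BZ1.toTerm]

theorem Term.toTerm_toTree (t : Term) : t.toTree.toTerm = t := by
  induction t with
  | idx n => simp only [Term.toTree, BZ1.toTerm, BZ2.toTerm_leftPath]
  | app t u iht ihu => simp only [Term.toTree, BZ1.toTerm, BZ1.toTerm_apply, iht, ihu]
  | abs t ih => simp only [Term.toTree, BZ1.toTerm, ih]

/-- The bijection between terms and zigzag-free trees. -/
def Term.equivTree : Term ≃ BZ1 where
  toFun := Term.toTree
  invFun := BZ1.toTerm
  left_inv := Term.toTerm_toTree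
  right_inv := BZ1.toTree_toTerm

theorem Term.size_equivTree (t : Term) : (Term.equivTree t).size = t.size := by
  rw [← BZ1.size_toTerm]
  exact congrArg Term.size t.toTerm_toTree

theorem lambda_eq_zigzagfree :
    ∀ n : ℕ, L n = Nat.card {t : BZ1 // t.size = n} := by
  intro n
  exact Nat.card_congr (Term.equivTree.subtypeEquiv fun t => by rw [t.size_equivTree])
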